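/- Let U ⊆ ℝ² be an open connected set, f = (f₁, f₂) : U → ℝ² an injective C² map with det Df(z) ≠ 0 for every z ∈ U, and z₀ ∈ U a point with f(z₀) = (0,0). Then every point z ∈ U \ {z₀} lies on a periodic solution of ∇H_f^⊥ whose image is contained in U if and only if f(U) = ℝ² or f(U) is an open disc centered at the origin (f(U) = {w ∈ ℝ² : ‖w‖ < r} for some r > 0). -/

import Mathlib

open Real Set

/-- Partial derivative in the `x` direction. -/
noncomputable def pdx (g : ℝ × ℝ → ℝ) (z : ℝ × ℝ) : ℝ := fderiv ℝ g z (1, 0)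

/-- Partial derivative in the `y` direction. -/
noncomputable def pdy (g : ℝ × ℝ → ℝ) (z : ℝ × ℝ) : ℝ := fderiv ℝ g z (0, 1)

/-- The Hamiltonian `H_f = (f₁² + f₂²)/2`. -/
noncomputable def Ham (f : ℝ × ℝ → ℝ × ℝ) (z : ℝ × ℝ) : ℝ :=
  ((f z).1 ^ 2 + (f z).2 ^ 2) / 2

/-- The Hamiltonian vector field `∇H_f^⊥ = (−∂H_f/∂y, ∂H_f/∂x)`. -/
noncomputable def hamVF (f : ℝ × ℝ → ℝ × ℝ) (z : ℝ × ℝ) : ℝ × ℝ :=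
  (-(pdy (Ham f) z), pdx (Ham f) z)

/-- The Jacobian determinant `det Df = ∂f₁/∂x ∂f₂/∂y − ∂f₂/∂x ∂f₁/∂y`. -/
noncomputable def jacDet (f : ℝ × ℝ → ℝ × ℝ) (z : ℝ × ℝ) : ℝ :=
  pdx (fun w => (f w).1) z * pdy (fun w => (f w).2) z -
    pdx (fun w => (f w).2) z * pdy (fun w => (f w).1) z

/-- `γ` is a periodic solution of the vector field `X` whose image is contained in `S`:
a non-constant `C¹` curve solving `γ' = X ∘ γ` with some period `T > 0`. -/
def IsPeriodicSolOn (X : ℝ × ℝ → ℝ × ℝ) (S : Set (ℝ × ℝ)) (γ : ℝ → ℝ × ℝ) : Prop :=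
  (∀ t, γ t ∈ S) ∧ (∀ t, HasDerivAt γ (X (γ t)) t) ∧
    (∃ T > 0, ∀ t, γ (t + T) = γ t) ∧ ∃ t s, γ t ≠ γ s

/-- The Euclidean norm on `ℝ²`. -/
noncomputable def euclNorm (w : ℝ × ℝ) : ℝ := Real.sqrt (w.1 ^ 2 + w.2 ^ 2)

/-- The open Euclidean disc of radius `r` centered at the origin. -/
def disc (r : ℝ) : Set (ℝ × ℝ) := {w | euclNorm w < r}

/-- `W` is the period annulus of the singular point `z₀` of the vector field `X` on `U`:
the maximal open connected subset of `U` containing `z₀` all whose points other than `z₀`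
lie on periodic solutions of `X` contained in `W`. -/
def IsPeriodAnnulus (X : ℝ × ℝ → ℝ × ℝ) (U : Set (ℝ × ℝ)) (z₀ : ℝ × ℝ)
    (W : Set (ℝ × ℝ)) : Prop :=
  z₀ ∈ W ∧ W ⊆ U ∧ IsOpen W ∧ IsConnected W ∧
    (∀ z ∈ W \ {z₀}, ∃ γ, IsPeriodicSolOn X W γ ∧ γ 0 = z) ∧
    ∀ W', z₀ ∈ W' → W' ⊆ U → IsOpen W' → IsConnected W' →
      (∀ z ∈ W' \ {z₀}, ∃ γ, IsPeriodicSolOn X W' γ ∧ γ 0 = z) → W ⊆ W' → W' = W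

/-- Rotation of the plane about the origin by the angle `φ`. -/
noncomputable def planeRot (φ : ℝ) (w : ℝ × ℝ) : ℝ × ℝ :=
  (w.1 * Real.cos φ - w.2 * Real.sin φ, w.1 * Real.sin φ + w.2 * Real.cos φ)

lemma planeRot_zero (w : ℝ × ℝ) : planeRot 0 w = w := by
  simp [planeRot]

lemma euclNorm_planeRot (φ : ℝ) (w : ℝ × ℝ) : euclNorm (planeRot φ w) = euclNorm w := by
  unfold euclNorm planeRot
  congr 1
  linear_combination (w.1 ^ 2 + w.2 ^ 2) * Real.sin_sq_add_cos_sq φ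

lemma hasDerivAt_planeRot (w : ℝ × ℝ) (φ : ℝ) :
    HasDerivAt (fun φ => planeRot φ w) (-(planeRot φ w).2, (planeRot φ w).1) φ := by
  have h₁ := ((Real.hasDerivAt_cos φ).const_mul w.1).sub ((Real.hasDerivAt_sin φ).const_mul w.2)
  have h₂ := ((Real.hasDerivAt_sin φ).const_mul w.1).add ((Real.hasDerivAt_cos φ).const_mul w.2)
  refine (h₁.prodMk h₂).congr_deriv ?_
  ext <;> simp only [planeRot] <;> ring

lemma planeRot_add_int_mul_two_pi (φ : ℝ) (n : ℤ) (w : ℝ × ℝ) :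
    planeRot (φ + n * (2 * Real.pi)) w = planeRot φ w := by
  simp [planeRot, Real.cos_add_int_mul_two_pi, Real.sin_add_int_mul_two_pi]

lemma exists_planeRot_eq {u w : ℝ × ℝ} (h : euclNorm u = euclNorm w) :
    ∃ φ, planeRot φ w = u := by
  have hsq : u.1 ^ 2 + u.2 ^ 2 = w.1 ^ 2 + w.2 ^ 2 :=
    (Real.sqrt_inj (by positivity) (by positivity)).1 h
  by_cases hw : w.1 ^ 2 + w.2 ^ 2 = 0
  · refine ⟨0, ?_⟩
    rw [planeRot_zero]
    have hzero : ∀ a b : ℝ, a ^ 2 + b ^ 2 = 0 → a = 0 ∧ b = 0 := fun a b hab =>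
      ⟨pow_eq_zero_iff two_ne_zero |>.1 (by nlinarith [sq_nonneg a, sq_nonneg b]),
        pow_eq_zero_iff two_ne_zero |>.1 (by nlinarith [sq_nonneg a, sq_nonneg b])⟩
    obtain ⟨hw₁, hw₂⟩ := hzero _ _ hw
    obtain ⟨hu₁, hu₂⟩ := hzero _ _ (hsq.trans hw)
    exact Prod.ext (hw₁.trans hu₁.symm) (hw₂.trans hu₂.symm)
  · set z : ℂ := ⟨(u.1 * w.1 + u.2 * w.2) / (w.1 ^ 2 + w.2 ^ 2),
      (w.1 * u.2 - w.2 * u.1) / (w.1 ^ 2 + w.2 ^ 2)⟩ with hz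
    have hn : ‖z‖ = 1 := by
      rw [Complex.norm_eq_sqrt_sq_add_sq, Real.sqrt_eq_one, hz]
      field_simp
      linear_combination (w.1 ^ 2 + w.2 ^ 2) * hsq
    have hc := Complex.norm_mul_cos_arg z
    have hs := Complex.norm_mul_sin_arg z
    rw [hn, one_mul] at hc hs
    refine ⟨z.arg, ?_⟩
    ext <;> simp only [planeRot, hc, hs] <;> simp only [hz] <;> field_simp <;> ring

lemma planeRot_pi_ne_self {w : ℝ × ℝ} (hw : w ≠ (0, 0)) : planeRot Real.pi w ≠ w := by
  intro h
  simp only [planeRot, Real.cos_pi, Real.sin_pi, Prod.ext_iff] at h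
  exact hw (Prod.ext (by linarith [h.1]) (by linarith [h.2]))

lemma continuous_euclNorm : Continuous euclNorm := by
  unfold euclNorm
  fun_prop

lemma surjective_intervalIntegral_of_pos {h : ℝ → ℝ} (hc : Continuous h) {T : ℝ} (hT : 0 < T)
    (hp : Function.Periodic h T) (hpos : ∀ t, 0 < h t) :
    Function.Surjective fun t => ∫ s in (0 : ℝ)..t, h s :=
  (intervalIntegral.continuous_primitive (fun a b => hc.intervalIntegrable a b) 0).surjective
    (hp.tendsto_atTop_intervalIntegral_of_pos' (hc.intervalIntegrable 0 T) hpos hT)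
    (hp.tendsto_atBot_intervalIntegral_of_pos' (hc.intervalIntegrable 0 T) hpos hT)

lemma forall_pos_or_forall_neg {h : ℝ → ℝ} (hc : Continuous h) (h0 : ∀ t, h t ≠ 0) :
    (∀ t, 0 < h t) ∨ ∀ t, h t < 0 := by
  by_contra! hcon
  obtain ⟨⟨a, ha⟩, b, hb⟩ := hcon
  obtain ⟨c, hc⟩ := mem_range_of_exists_le_of_exists_ge hc ⟨a, ha⟩ ⟨b, hb⟩
  exact h0 c hc

lemma surjective_intervalIntegral_of_ne_zero {h : ℝ → ℝ} (hc : Continuous h) {T : ℝ}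
    (hT : 0 < T) (hp : Function.Periodic h T) (h0 : ∀ t, h t ≠ 0) :
    Function.Surjective fun t => ∫ s in (0 : ℝ)..t, h s := by
  rcases forall_pos_or_forall_neg hc h0 with hpos | hneg
  · exact surjective_intervalIntegral_of_pos hc hT hp hpos
  · intro y
    obtain ⟨t, ht⟩ := surjective_intervalIntegral_of_pos hc.neg hT
      (fun t => by simp [hp t]) (fun t => neg_pos.2 (hneg t)) (-y)
    refine ⟨t, ?_⟩
    simpa using ht

/-- A positive continuous periodic autonomous scalar equation has a global solution, which winds
around the circle. -/
lemma exists_winding_solution_of_pos {j : ℝ → ℝ} (hc : Continuous j) {T : ℝ} (hT : 0 < T)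
    (hp : Function.Periodic j T) (hpos : ∀ t, 0 < j t) :
    ∃ (θ : ℝ → ℝ) (P : ℝ), 0 < P ∧ θ 0 = 0 ∧ (∀ t, HasDerivAt θ (j (θ t)) t) ∧
      Function.Surjective θ ∧ ∀ t, θ (t + P) = θ t + T := by
  set F : ℝ → ℝ := fun t => ∫ s in (0 : ℝ)..t, (j s)⁻¹ with hF
  have hic : Continuous fun s => (j s)⁻¹ := hc.inv₀ fun t => (hpos t).ne'
  have hip : Function.Periodic (fun s => (j s)⁻¹) T := fun t => by simp [hp t]
  have hd : ∀ t, HasDerivAt F (j t)⁻¹ t := fun t => hic.integral_hasStrictDerivAt 0 t |>.hasDerivAt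
  have hmono : StrictMono F := strictMono_of_hasDerivAt_pos hd fun t => inv_pos.2 (hpos t)
  have hsurj : Function.Surjective F :=
    surjective_intervalIntegral_of_pos hic hT hip fun t => inv_pos.2 (hpos t)
  have hF0 : F 0 = 0 := by simp [hF]
  have hadd : ∀ t, F (t + T) = F t + F T := fun t => by
    have := hip.intervalIntegral_add_eq_add 0 t fun a b => hic.intervalIntegrable a b
    simpa [hF] using this
  let e := hmono.orderIsoOfSurjective F hsurj
  have hFe : ∀ t, F (e.symm t) = t := fun t => e.apply_symm_apply t
  have heF : ∀ t, e.symm (F t) = t := fun t => e.symm_apply_apply t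
  refine ⟨e.symm, F T, hF0 ▸ hmono hT, ?_, fun t => ?_, e.symm.surjective, fun t => ?_⟩
  · simpa [hF0] using heF 0
  · have := HasDerivAt.of_local_left_inverse e.symm.continuous.continuousAt (hd (e.symm t))
      (inv_ne_zero (hpos _).ne') (Filter.Eventually.of_forall hFe)
    simpa using this
  · rw [← heF (e.symm t + T), hadd, hFe]

lemma exists_winding_solution {j : ℝ → ℝ} (hc : Continuous j) {T : ℝ} (hT : 0 < T)
    (hp : Function.Periodic j T) (h0 : ∀ t, j t ≠ 0) :
    ∃ (θ : ℝ → ℝ) (P : ℝ), 0 < P ∧ θ 0 = 0 ∧ (∀ t, HasDerivAt θ (j (θ t)) t) ∧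
      Function.Surjective θ ∧ ∀ t, ∃ n : ℤ, θ (t + P) = θ t + n * T := by
  rcases forall_pos_or_forall_neg hc h0 with hpos | hneg
  · obtain ⟨θ, P, hP, hθ0, hd, hs, hper⟩ := exists_winding_solution_of_pos hc hT hp hpos
    exact ⟨θ, P, hP, hθ0, hd, hs, fun t => ⟨1, by simp [hper t]⟩⟩
  · obtain ⟨θ, P, hP, hθ0, hd, hs, hper⟩ := exists_winding_solution_of_pos hc.neg hT
      (fun t => by simp [hp t]) (fun t => neg_pos.2 (hneg t))
    refine ⟨fun t => θ (-t), P, hP, by simpa using hθ0, fun t => ?_,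
      hs.comp neg_surjective, fun t => ⟨-1, ?_⟩⟩
    · simpa [Function.comp_def] using (hd (-t)).comp t (hasDerivAt_neg t)
    · have := hper (-(t + P))
      rw [show -(t + P) + P = -t by ring] at this
      simp only [this]
      push_cast
      ring

/-- A plane curve with velocity `J(t)` times the quarter turn of its position is a rotation of its
initial point, with angle the primitive of `J`. -/
lemma eq_planeRot_of_hasDerivAt {J : ℝ → ℝ} (hJ : Continuous J) {w : ℝ → ℝ × ℝ}
    (hw : ∀ t, HasDerivAt w (-(J t * (w t).2), J t * (w t).1) t) (t : ℝ) :
    w t = planeRot (∫ s in (0 : ℝ)..t, J s) (w 0) := by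
  set Θ : ℝ → ℝ := fun t => ∫ s in (0 : ℝ)..t, J s with hΘ
  have hd : ∀ t, HasDerivAt Θ (J t) t := fun t => hJ.integral_hasStrictDerivAt 0 t |>.hasDerivAt
  have h₁ : ∀ t, HasDerivAt (fun t => (w t).1) (-(J t * (w t).2)) t := fun t =>
    (hasFDerivAt_fst (p := w t)).comp_hasDerivAt t (hw t)
  have h₂ : ∀ t, HasDerivAt (fun t => (w t).2) (J t * (w t).1) t := fun t =>
    (hasFDerivAt_snd (p := w t)).comp_hasDerivAt t (hw t)
  have hA : ∀ t, HasDerivAt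
      (fun t => (w t).1 * Real.cos (Θ t) + (w t).2 * Real.sin (Θ t)) 0 t := fun t =>
    (((h₁ t).mul (hd t).cos).add ((h₂ t).mul (hd t).sin)).congr_deriv (by ring)
  have hB : ∀ t, HasDerivAt
      (fun t => (w t).2 * Real.cos (Θ t) - (w t).1 * Real.sin (Θ t)) 0 t := fun t =>
    (((h₂ t).mul (hd t).cos).sub ((h₁ t).mul (hd t).sin)).congr_deriv (by ring)
  have hA' := is_const_of_deriv_eq_zero (fun t => (hA t).differentiableAt)
    (fun t => (hA t).deriv) t 0
  have hB' := is_const_of_deriv_eq_zero (fun t => (hB t).differentiableAt)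
    (fun t => (hB t).deriv) t 0
  have hΘ0 : Θ 0 = 0 := by simp [hΘ]
  simp only [hΘ0, Real.cos_zero, Real.sin_zero, mul_one, mul_zero, add_zero, sub_zero] at hA' hB'
  change w t = planeRot (Θ t) (w 0)
  have hcs := Real.sin_sq_add_cos_sq (Θ t)
  ext <;> simp only [planeRot, ← hA', ← hB']
  · linear_combination -(w t).1 * hcs
  · linear_combination -(w t).2 * hcs

/-- A connected open set containing the origin and invariant under rotations is the plane or an
open disc centered at the origin. -/
lemma eq_univ_or_eq_disc {V : Set (ℝ × ℝ)} (hVo : IsOpen V) (hVc : IsPreconnected V)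
    (h0 : ((0, 0) : ℝ × ℝ) ∈ V) (hrot : ∀ w ∈ V, ∀ φ, planeRot φ w ∈ V) :
    V = Set.univ ∨ ∃ r > 0, V = disc r := by
  have h00 : euclNorm (0, 0) = 0 := by simp [euclNorm]
  have hdown : ∀ w ∈ V, ∀ u, euclNorm u ≤ euclNorm w → u ∈ V := by
    intro w hw u hu
    have hoc := (hVc.image euclNorm continuous_euclNorm.continuousOn).ordConnected
    obtain ⟨v, hv, hvu⟩ := hoc.out ⟨_, h0, h00⟩ ⟨w, hw, rfl⟩ ⟨Real.sqrt_nonneg _, hu⟩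
    obtain ⟨φ, rfl⟩ := exists_planeRot_eq hvu.symm
    exact hrot v hv φ
  have hup : ∀ w ∈ V, ∃ u ∈ V, euclNorm w < euclNorm u := by
    intro w hw
    have hnorm : ∀ t : ℝ, 0 ≤ t → euclNorm (t, 0) = t := fun t ht => by
      simp [euclNorm, Real.sqrt_sq ht]
    have hn : 0 ≤ euclNorm w := Real.sqrt_nonneg _
    have hmem : ((euclNorm w, 0) : ℝ × ℝ) ∈ V := hdown w hw _ (hnorm _ hn).le
    have hcont : Continuous fun t : ℝ => ((t, 0) : ℝ × ℝ) := by fun_prop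
    have hev : ∀ᶠ t in nhds (euclNorm w), ((t, 0) : ℝ × ℝ) ∈ V :=
      (hVo.preimage hcont).mem_nhds hmem
    obtain ⟨ε, hε, hball⟩ := Metric.eventually_nhds_iff.1 hev
    refine ⟨(euclNorm w + ε / 2, 0), hball ?_, ?_⟩
    · rw [Real.dist_eq, add_sub_cancel_left, abs_of_pos (by positivity)]
      linarith
    · rw [hnorm _ (by positivity)]
      linarith
  by_cases hb : BddAbove (euclNorm '' V)
  · right
    have hlt : ∀ w ∈ V, euclNorm w < sSup (euclNorm '' V) := fun w hw => by
      obtain ⟨u, hu, hwu⟩ := hup w hw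
      exact hwu.trans_le (le_csSup hb ⟨u, hu, rfl⟩)
    refine ⟨sSup (euclNorm '' V), h00 ▸ hlt _ h0, Set.Subset.antisymm hlt fun u hu => ?_⟩
    obtain ⟨_, ⟨w, hw, rfl⟩, hlt'⟩ := exists_lt_of_lt_csSup (Set.Nonempty.image euclNorm ⟨_, h0⟩) hu
    exact hdown w hw u hlt'.le
  · left
    refine Set.eq_univ_of_forall fun u => ?_
    obtain ⟨_, ⟨w, hw, rfl⟩, hlt⟩ := not_bddAbove_iff.1 hb (euclNorm u)
    exact hdown w hw u hlt.le

section HamiltonianField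

variable {f : ℝ × ℝ → ℝ × ℝ} {z : ℝ × ℝ}

lemma fderiv_apply_eq_pdx_pdy (hf : DifferentiableAt ℝ f z) (v : ℝ × ℝ) :
    fderiv ℝ f z v =
      (v.1 * pdx (fun w => (f w).1) z + v.2 * pdy (fun w => (f w).1) z,
        v.1 * pdx (fun w => (f w).2) z + v.2 * pdy (fun w => (f w).2) z) := by
  have h₁ : fderiv ℝ (fun w => (f w).1) z = (ContinuousLinearMap.fst ℝ ℝ ℝ).comp (fderiv ℝ f z) :=
    (hasFDerivAt_fst.comp z hf.hasFDerivAt).fderiv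
  have h₂ : fderiv ℝ (fun w => (f w).2) z = (ContinuousLinearMap.snd ℝ ℝ ℝ).comp (fderiv ℝ f z) :=
    (hasFDerivAt_snd.comp z hf.hasFDerivAt).fderiv
  have hv : v = v.1 • ((1, 0) : ℝ × ℝ) + v.2 • ((0, 1) : ℝ × ℝ) := by ext <;> simp
  conv_lhs => rw [hv, map_add, map_smul, map_smul]
  ext <;> simp [pdx, pdy, h₁, h₂]

lemma hamVF_eq (hf : DifferentiableAt ℝ f z) :
    hamVF f z =
      (-((f z).1 * pdy (fun w => (f w).1) z + (f z).2 * pdy (fun w => (f w).2) z),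
        (f z).1 * pdx (fun w => (f w).1) z + (f z).2 * pdx (fun w => (f w).2) z) := by
  have h₁ : HasFDerivAt (fun w => (f w).1) (fderiv ℝ (fun w => (f w).1) z) z :=
    hf.fst.hasFDerivAt
  have h₂ : HasFDerivAt (fun w => (f w).2) (fderiv ℝ (fun w => (f w).2) z) z :=
    hf.snd.hasFDerivAt
  have h : HasFDerivAt (Ham f) ((f z).1 • fderiv ℝ (fun w => (f w).1) z +
      (f z).2 • fderiv ℝ (fun w => (f w).2) z) z := by
    have := ((h₁.pow 2).add (h₂.pow 2)).mul_const (1 / 2 : ℝ)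
    refine (this.congr_fderiv ?_).congr_of_eventuallyEq (Filter.Eventually.of_forall fun w => ?_)
    · ext <;> simp <;> ring
    · simp [Ham]; ring
  simp [hamVF, pdx, pdy, h.fderiv]

/-- In the coordinates given by `f` the Hamiltonian field is the rotation field scaled by the
Jacobian determinant. -/
lemma fderiv_hamVF (hf : DifferentiableAt ℝ f z) :
    fderiv ℝ f z (hamVF f z) = (-(jacDet f z * (f z).2), jacDet f z * (f z).1) := by
  rw [fderiv_apply_eq_pdx_pdy hf, hamVF_eq hf]
  ext <;> simp only [jacDet] <;> ring

lemma exists_equiv_fderiv (hf : DifferentiableAt ℝ f z) (hdet : jacDet f z ≠ 0) :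
    ∃ e : (ℝ × ℝ) ≃L[ℝ] ℝ × ℝ, (e : ℝ × ℝ →L[ℝ] ℝ × ℝ) = fderiv ℝ f z := by
  have hinj : Function.Injective (fderiv ℝ f z : ℝ × ℝ →ₗ[ℝ] ℝ × ℝ) := by
    rw [← LinearMap.ker_eq_bot, LinearMap.ker_eq_bot']
    intro v hv
    have hv' : fderiv ℝ f z v = 0 := hv
    rw [fderiv_apply_eq_pdx_pdy hf, Prod.mk_eq_zero] at hv'
    obtain ⟨h₁, h₂⟩ := hv'
    refine Prod.ext ((mul_eq_zero.1 (?_ : v.1 * jacDet f z = 0)).resolve_right hdet)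
      ((mul_eq_zero.1 (?_ : v.2 * jacDet f z = 0)).resolve_right hdet)
    · unfold jacDet
      linear_combination pdy (fun w => (f w).2) z * h₁ - pdy (fun w => (f w).1) z * h₂
    · unfold jacDet
      linear_combination pdx (fun w => (f w).1) z * h₂ - pdx (fun w => (f w).2) z * h₁
  exact ⟨(LinearEquiv.ofInjectiveEndo _ hinj).toContinuousLinearEquiv, by ext <;> rfl⟩

end HamiltonianField

lemma continuousOn_jacDet {U : Set (ℝ × ℝ)} (hUo : IsOpen U) {f : ℝ × ℝ → ℝ × ℝ}
    (hf : ContDiffOn ℝ 1 f U) : ContinuousOn (jacDet f) U := by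
  have h₁ := hf.fst.continuousOn_fderiv_of_isOpen hUo le_rfl
  have h₂ := hf.snd.continuousOn_fderiv_of_isOpen hUo le_rfl
  unfold jacDet pdx pdy
  fun_prop

theorem global_center_iff_image_of_injective (U : Set (ℝ × ℝ)) (hUo : IsOpen U)
    (hUc : IsConnected U) (f : ℝ × ℝ → ℝ × ℝ) (hf : ContDiffOn ℝ 2 f U)
    (hinj : Set.InjOn f U) (hdet : ∀ z ∈ U, jacDet f z ≠ 0)
    (z₀ : ℝ × ℝ) (hz₀ : z₀ ∈ U) (hfz : f z₀ = (0, 0)) :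
    (∀ z ∈ U \ {z₀}, ∃ γ, IsPeriodicSolOn (hamVF f) U γ ∧ γ 0 = z) ↔
      (f '' U = Set.univ ∨ ∃ r > 0, f '' U = disc r) := by
  have hdiff : ∀ z ∈ U, DifferentiableAt ℝ f z := fun z hz =>
    (hf.contDiffAt (hUo.mem_nhds hz)).differentiableAt (by norm_num)
  have hJc : ContinuousOn (jacDet f) U := continuousOn_jacDet hUo (hf.of_le (by norm_num))
  have hstrict : ∀ z ∈ U, ∃ e : (ℝ × ℝ) ≃L[ℝ] ℝ × ℝ,
      (e : ℝ × ℝ →L[ℝ] ℝ × ℝ) = fderiv ℝ f z ∧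
        HasStrictFDerivAt f (e : ℝ × ℝ →L[ℝ] ℝ × ℝ) z := fun z hz => by
    obtain ⟨e, he⟩ := exists_equiv_fderiv (hdiff z hz) (hdet z hz)
    exact ⟨e, he, he ▸ (hf.contDiffAt (hUo.mem_nhds hz)).hasStrictFDerivAt (by norm_num)⟩
  constructor
  · intro h
    have hopen : IsOpen (f '' U) := by
      rw [isOpen_iff_mem_nhds]
      rintro _ ⟨z, hz, rfl⟩
      obtain ⟨e, -, he⟩ := hstrict z hz
      rw [← he.map_nhds_eq_of_equiv]
      exact Filter.image_mem_map (hUo.mem_nhds hz)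
    refine eq_univ_or_eq_disc hopen (hUc.isPreconnected.image f hf.continuousOn)
      ⟨z₀, hz₀, hfz⟩ ?_
    rintro _ ⟨z, hz, rfl⟩ φ
    by_cases hzz : z = z₀
    · refine ⟨z₀, hz₀, ?_⟩
      simp [hzz, hfz, planeRot]
    obtain ⟨γ, ⟨hγU, hγ, ⟨T, hT, hper⟩, -⟩, rfl⟩ := h z ⟨hz, hzz⟩
    have hγc : Continuous γ := continuous_iff_continuousAt.2 fun t => (hγ t).continuousAt
    have hJγ : Continuous fun t => jacDet f (γ t) := hJc.comp_continuous hγc hγU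
    have hw : ∀ t, HasDerivAt (fun t => f (γ t))
        (-(jacDet f (γ t) * (f (γ t)).2), jacDet f (γ t) * (f (γ t)).1) t := fun t => by
      rw [← fderiv_hamVF (hdiff _ (hγU t))]
      exact (hdiff _ (hγU t)).hasFDerivAt.comp_hasDerivAt t (hγ t)
    obtain ⟨t, ht⟩ := surjective_intervalIntegral_of_ne_zero hJγ hT
      (fun t => by simp only [hper t]) (fun t => hdet _ (hγU t)) φ
    refine ⟨γ t, hγU t, ?_⟩
    rw [eq_planeRot_of_hasDerivAt hJγ hw t]
    exact congrArg (planeRot · (f (γ 0))) ht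
  · intro hV z hz
    have hcirc : ∀ φ, planeRot φ (f z) ∈ f '' U := fun φ => by
      have hfzV : f z ∈ f '' U := ⟨z, hz.1, rfl⟩
      rcases hV with hV | ⟨r, -, hV⟩
      · rw [hV]; trivial
      · rw [hV] at hfzV ⊢
        exact (euclNorm_planeRot φ (f z)).trans_lt hfzV
    set g := Function.invFunOn f U
    have hgU : ∀ φ, g (planeRot φ (f z)) ∈ U := fun φ => Function.invFunOn_mem (hcirc φ)
    have hfg : ∀ φ, f (g (planeRot φ (f z))) = planeRot φ (f z) := fun φ =>
      Function.invFunOn_eq (hcirc φ)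
    have hgf : ∀ u ∈ U, g (f u) = u := fun u hu => hinj.leftInvOn_invFunOn hu
    have hgd : ∀ φ, ∃ e : (ℝ × ℝ) ≃L[ℝ] ℝ × ℝ,
        (e : ℝ × ℝ →L[ℝ] ℝ × ℝ) = fderiv ℝ f (g (planeRot φ (f z))) ∧
          HasFDerivAt g (e.symm : ℝ × ℝ →L[ℝ] ℝ × ℝ) (planeRot φ (f z)) := fun φ => by
      obtain ⟨e, he, hs⟩ := hstrict _ (hgU φ)
      have := hs.to_local_left_inverse
        (Filter.eventually_of_mem (hUo.mem_nhds (hgU φ)) hgf)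
      rw [hfg] at this
      exact ⟨e, he, this.hasFDerivAt⟩
    have hgc : Continuous fun φ => g (planeRot φ (f z)) := continuous_iff_continuousAt.2 fun φ => by
      obtain ⟨e, -, he⟩ := hgd φ
      exact (he.comp_hasDerivAt φ (hasDerivAt_planeRot (f z) φ)).continuousAt
    obtain ⟨θ, P, hP, hθ0, hθ, hθs, hθp⟩ := exists_winding_solution
      (hJc.comp_continuous hgc hgU) Real.two_pi_pos
      (fun φ => by
        have := planeRot_add_int_mul_two_pi φ 1 (f z)
        rw [Int.cast_one, one_mul] at this
        exact congrArg (fun w => jacDet f (g w)) this)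
      (fun φ => hdet _ (hgU φ))
    refine ⟨fun t => g (planeRot (θ t) (f z)),
      ⟨fun t => hgU _, fun t => ?_, ⟨P, hP, fun t => ?_⟩, ?_⟩, ?_⟩
    · obtain ⟨e, he, hge⟩ := hgd (θ t)
      have hd := hge.comp_hasDerivAt t ((hasDerivAt_planeRot (f z) (θ t)).scomp t (hθ t))
      refine hd.congr_deriv ((e.symm_apply_eq).2 ?_)
      have := fderiv_hamVF (hdiff _ (hgU (θ t)))
      rw [← he, hfg] at this
      refine Eq.trans ?_ this.symm
      ext <;> simp
    · obtain ⟨n, hn⟩ := hθp t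
      simp only [hn, planeRot_add_int_mul_two_pi]
    · obtain ⟨t, ht⟩ := hθs Real.pi
      refine ⟨t, 0, fun heq => ?_⟩
      simp only [ht, hθ0] at heq
      have heq' := congrArg f heq
      rw [hfg, hfg, planeRot_zero] at heq'
      refine planeRot_pi_ne_self (fun h0 => hz.2 ?_) heq'
      exact hinj hz.1 hz₀ (h0.trans hfz.symm)
    · simp only [hθ0, planeRot_zero]
      exact hgf z hz.1
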